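/- Let A be a 3×3 real matrix with trace zero which is invertible (equivalently, no eigenvalue of A is zero). Then A has a complex eigenvalue with strictly positive real part and a complex eigenvalue with strictly negative real part. (This is the linear-algebraic content of the claim that every nondegenerate fixed point of a volume-preserving flow in dimension three is of saddle type.) -/

import Mathlib

/-- If three complex numbers have sum with zero real part, and product with nonzero real part,
then one of them has positive and one of them has negative real part. -/
theorem Complex.exists_re_pos_and_exists_re_neg_of_triple {a b c : ℂ}
    (hsum : (a + b + c).re = 0) (hprod : (a * b * c).re ≠ 0) :
    (0 < a.re ∨ 0 < b.re ∨ 0 < c.re) ∧ (a.re < 0 ∨ b.re < 0 ∨ c.re < 0) := by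
  simp only [Complex.add_re] at hsum
  have not_all_imaginary : ¬ (a.re = 0 ∧ b.re = 0 ∧ c.re = 0) := by
    rintro ⟨ha, hb, hc⟩
    exact hprod (by simp [Complex.mul_re, Complex.mul_im, ha, hb, hc])
  constructor <;> by_contra! h <;> obtain ⟨ha, hb, hc⟩ := h <;>
    exact not_all_imaginary ⟨by linarith, by linarith, by linarith⟩

/-- The complex eigenvalues of a real 3×3 matrix, listed with multiplicity, have sum equal to
the trace and product equal to the determinant. -/
theorem Matrix.exists_complex_roots_charpoly_fin_three (A : Matrix (Fin 3) (Fin 3) ℝ) :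
    ∃ a b c : ℂ, (A.map (fun r : ℝ => (r : ℂ))).charpoly.roots = {a, b, c} ∧
      a + b + c = (A.trace : ℂ) ∧ a * b * c = (A.det : ℂ) := by
  set B := A.map (fun r : ℝ => (r : ℂ))
  have hsplits : B.charpoly.Splits := IsAlgClosed.splits _
  have hcard : B.charpoly.roots.card = 3 := by
    rw [← hsplits.natDegree_eq_card_roots, Matrix.charpoly_natDegree_eq_dim, Fintype.card_fin]
  obtain ⟨a, b, c, hroots⟩ := Multiset.card_eq_three.mp hcard
  have htrace : B.trace = (A.trace : ℂ) := (AddMonoidHom.map_trace Complex.ofRealHom A).symm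
  have hdet : B.det = (A.det : ℂ) := (RingHom.map_det Complex.ofRealHom A).symm
  refine ⟨a, b, c, hroots, ?_, ?_⟩
  · rw [← htrace, Matrix.trace_eq_sum_roots_charpoly_of_splits hsplits, hroots]
    simp [add_assoc]
  · rw [← hdet, Matrix.det_eq_prod_roots_charpoly_of_splits hsplits, hroots]
    simp [mul_assoc]

/-- A 3×3 real matrix with trace zero which is invertible has a complex eigenvalue
with strictly positive real part and a complex eigenvalue with strictly negative
real part.  Eigenvalues of the real matrix `A` are taken over ℂ, i.e. roots of the
characteristic polynomial of `A` regarded as a complex matrix. -/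
theorem trace_zero_invertible_matrix_saddle
    (A : Matrix (Fin 3) (Fin 3) ℝ) (htr : Matrix.trace A = 0) (hinv : IsUnit A.det) :
    (∃ z : ℂ, (Matrix.charpoly (A.map (fun r : ℝ => (r : ℂ)))).IsRoot z ∧ 0 < z.re) ∧
    (∃ z : ℂ, (Matrix.charpoly (A.map (fun r : ℝ => (r : ℂ)))).IsRoot z ∧ z.re < 0) := by
  obtain ⟨a, b, c, hroots, hsum, hprod⟩ := A.exists_complex_roots_charpoly_fin_three
  have isRoot_of_mem : ∀ z ∈ ({a, b, c} : Multiset ℂ),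
      (Matrix.charpoly (A.map (fun r : ℝ => (r : ℂ)))).IsRoot z := fun z hz =>
    Polynomial.isRoot_of_mem_roots (hroots ▸ hz)
  have ha := isRoot_of_mem a (by simp)
  have hb := isRoot_of_mem b (by simp)
  have hc := isRoot_of_mem c (by simp)
  obtain ⟨hpos, hneg⟩ := Complex.exists_re_pos_and_exists_re_neg_of_triple
    (a := a) (b := b) (c := c) (by simp [hsum, htr])
    (by rw [hprod, Complex.ofReal_re]; exact hinv.ne_zero)
  constructor
  · rcases hpos with h | h | h
    exacts [⟨a, ha, h⟩, ⟨b, hb, h⟩, ⟨c, hc, h⟩]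
  · rcases hneg with h | h | h
    exacts [⟨a, ha, h⟩, ⟨b, hb, h⟩, ⟨c, hc, h⟩]
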